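/- arXiv:2201.00450 — 3 statements merged into one kernel-verified Lean document; each statement's English description precedes it below -/
import Mathlib

section
/- Let y ∈ ℝⁿ, let X be a real n×d matrix of rank d with singular value decomposition X = U D Vᵀ, let S be a k×n matrix that is an ε-subspace embedding for X with ε < 1/2 and such that X̃ᵀX̃ is invertible where X̃ = SX. Then for every starting value β^{(0)} ∈ ℝ^d, the iteration β^{(t+1)} = β^{(t)} + (X̃ᵀX̃)^{-1}Xᵀ(y − Xβ^{(t)}) satisfies ‖β_F − β^{(t)}‖₂ → 0 as t → ∞, where β_F = (XᵀX)^{-1}Xᵀy. -/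
open MeasureTheory ProbabilityTheory Matrix Filter
open scoped ENNReal NNReal

/-- The Euclidean norm `‖v‖₂` of a vector in `ℝ^d`. -/
noncomputable def norm2 {d : ℕ} (v : Fin d → ℝ) : ℝ := Real.sqrt (∑ i, (v i) ^ 2)

/-- `S` is an `ε`-subspace embedding for `A` if `(1-ε)‖Az‖² ≤ ‖SAz‖² ≤ (1+ε)‖Az‖²`
for every `z ∈ ℝ^d` (Euclidean norms). -/
def IsSubspaceEmbedding {k n d : ℕ} (S : Matrix (Fin k) (Fin n) ℝ)
    (A : Matrix (Fin n) (Fin d) ℝ) (ε : ℝ) : Prop :=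
  ∀ z : Fin d → ℝ,
    (1 - ε) * (∑ i, (A.mulVec z i) ^ 2) ≤ (∑ i, ((S * A).mulVec z i) ^ 2) ∧
    (∑ i, ((S * A).mulVec z i) ^ 2) ≤ (1 + ε) * (∑ i, (A.mulVec z i) ^ 2)

/-- One step of the sketched-preconditioner iteration
`β ↦ β + (X̃ᵀ X̃)⁻¹ Xᵀ (y − X β)` where `X̃ = S X`. -/
noncomputable def lsIter {n d k : ℕ} (y : Fin n → ℝ) (X : Matrix (Fin n) (Fin d) ℝ)
    (S : Matrix (Fin k) (Fin n) ℝ) (β : Fin d → ℝ) : Fin d → ℝ :=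
  β + ((S * X)ᵀ * (S * X))⁻¹.mulVec (Xᵀ.mulVec (y - X.mulVec β))

/-- The ordinary least-squares solution `β_F = (Xᵀ X)⁻¹ Xᵀ y`. -/
noncomputable def lsSol {n d : ℕ} (y : Fin n → ℝ) (X : Matrix (Fin n) (Fin d) ℝ) :
    Fin d → ℝ :=
  ((Xᵀ * X)⁻¹ * Xᵀ).mulVec y

theorem sum_mulVec_sq_eq_dotProduct {m d : ℕ} (A : Matrix (Fin m) (Fin d) ℝ)
    (z : Fin d → ℝ) : ∑ i, (A.mulVec z i) ^ 2 = A *ᵥ z ⬝ᵥ A *ᵥ z := by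
  simp [dotProduct, sq]

theorem two_mul_dotProduct_le {n : ℕ} (a b : Fin n → ℝ) {s : ℝ} (hs : 0 < s) :
    2 * (a ⬝ᵥ b) ≤ s * (a ⬝ᵥ a) + (b ⬝ᵥ b) / s := by
  simp only [dotProduct, Finset.mul_sum, Finset.sum_div]
  rw [← Finset.sum_add_distrib]
  refine Finset.sum_le_sum fun i _ => ?_
  have h : s * (a i * a i) + b i * b i / s - 2 * (a i * b i) = (s * a i - b i) ^ 2 / s := by
    field_simp
    ring
  have : 0 ≤ (s * a i - b i) ^ 2 / s := by positivity
  linarith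

/-- If `Bᵀ B w = Aᵀ A e` and `BᵀB` is spectrally `ε`-close to `AᵀA`, then replacing `e` by
`e - w` contracts the energy `‖B e‖²`. -/
theorem energy_sub_le {m n d : ℕ} (A : Matrix (Fin n) (Fin d) ℝ) (B : Matrix (Fin m) (Fin d) ℝ)
    {ε : ℝ} (hε : 0 < ε) (hε2 : ε < 1 / 2) (e w : Fin d → ℝ)
    (hw : (1 - ε) * (A *ᵥ w ⬝ᵥ A *ᵥ w) ≤ B *ᵥ w ⬝ᵥ B *ᵥ w)
    (he : B *ᵥ e ⬝ᵥ B *ᵥ e ≤ (1 + ε) * (A *ᵥ e ⬝ᵥ A *ᵥ e))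
    (h : (Bᵀ * B) *ᵥ w = (Aᵀ * A) *ᵥ e) :
    B *ᵥ (e - w) ⬝ᵥ B *ᵥ (e - w) ≤
      (1 - (1 - 2 * ε) / ((1 - ε) * (1 + ε))) * (B *ᵥ e ⬝ᵥ B *ᵥ e) := by
  have hpair : ∀ z : Fin d → ℝ, B *ᵥ z ⬝ᵥ B *ᵥ w = A *ᵥ z ⬝ᵥ A *ᵥ e := fun z => by
    have hz := congrArg (z ⬝ᵥ ·) h
    simpa only [← mulVec_mulVec, dotProduct_mulVec, vecMul_transpose] using hz
  have hww := hpair w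
  have hew := hpair e
  have hs : 0 < 1 - ε := by linarith
  have hyoung := two_mul_dotProduct_le (A *ᵥ w) (A *ᵥ e) hs
  have hexp : B *ᵥ (e - w) ⬝ᵥ B *ᵥ (e - w) =
      B *ᵥ e ⬝ᵥ B *ᵥ e - 2 * (B *ᵥ e ⬝ᵥ B *ᵥ w) + B *ᵥ w ⬝ᵥ B *ᵥ w := by
    rw [mulVec_sub, sub_dotProduct, dotProduct_sub, dotProduct_sub,
      dotProduct_comm (B *ᵥ w) (B *ᵥ e)]
    ring
  have hstep : (1 - 2 * ε) / ((1 - ε) * (1 + ε)) * (B *ᵥ e ⬝ᵥ B *ᵥ e) ≤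
      (1 - 2 * ε) / ((1 - ε) * (1 + ε)) * ((1 + ε) * (A *ᵥ e ⬝ᵥ A *ᵥ e)) :=
    mul_le_mul_of_nonneg_left he (div_nonneg (by linarith) (by positivity))
  have hcoef : (1 - 2 * ε) / ((1 - ε) * (1 + ε)) * ((1 + ε) * (A *ᵥ e ⬝ᵥ A *ᵥ e)) =
      2 * (A *ᵥ e ⬝ᵥ A *ᵥ e) - (A *ᵥ e ⬝ᵥ A *ᵥ e) / (1 - ε) := by
    field_simp
    ring
  rw [hexp, hew]
  linarith

theorem isUnit_det_transpose_mul_self_of_mul {k n d : ℕ} (S : Matrix (Fin k) (Fin n) ℝ)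
    (X : Matrix (Fin n) (Fin d) ℝ) (hinv : IsUnit ((S * X)ᵀ * (S * X)).det) :
    IsUnit (Xᵀ * X).det := by
  have hinj := mulVec_injective_iff_isUnit.2 ((isUnit_iff_isUnit_det _).2 hinv)
  rw [← isUnit_iff_isUnit_det, ← mulVec_injective_iff_isUnit]
  refine (injective_iff_map_eq_zero (Xᵀ * X).mulVecLin).2 fun z hz => hinj ?_
  have hXz : X *ᵥ z = 0 := by
    rw [← conjTranspose_mul_self_mulVec_eq_zero, conjTranspose_eq_transpose_of_trivial]
    exact hz
  simp only [mulVec_zero, ← mulVec_mulVec, hXz]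

theorem lsSol_sub_lsIter {n d k : ℕ} (y : Fin n → ℝ) (X : Matrix (Fin n) (Fin d) ℝ)
    (S : Matrix (Fin k) (Fin n) ℝ) (hX : IsUnit (Xᵀ * X).det) (β : Fin d → ℝ) :
    lsSol y X - lsIter y X S β = (lsSol y X - β) -
      ((S * X)ᵀ * (S * X))⁻¹ *ᵥ ((Xᵀ * X) *ᵥ (lsSol y X - β)) := by
  have hnormal : (Xᵀ * X) *ᵥ lsSol y X = Xᵀ *ᵥ y := by
    rw [lsSol, mulVec_mulVec, mul_nonsing_inv_cancel_left _ _ hX]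
  rw [mulVec_sub, hnormal, lsIter, mulVec_sub Xᵀ, mulVec_mulVec β Xᵀ X]
  abel

theorem tendsto_norm2_zero_of_energy {m d : ℕ} (B : Matrix (Fin m) (Fin d) ℝ)
    (hB : IsUnit (Bᵀ * B).det) (e : ℕ → Fin d → ℝ)
    (h : Tendsto (fun t => B *ᵥ e t ⬝ᵥ B *ᵥ e t) atTop (nhds 0)) :
    Tendsto (fun t => norm2 (e t)) atTop (nhds 0) := by
  have hBe : Tendsto (fun t => B *ᵥ e t) atTop (nhds 0) := by
    refine tendsto_pi_nhds.2 fun i => ?_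
    have hsqrt := (Real.continuous_sqrt.tendsto 0).comp h
    rw [Real.sqrt_zero] at hsqrt
    refine squeeze_zero_norm (fun t => Real.abs_le_sqrt ?_) hsqrt
    rw [← sum_mulVec_sq_eq_dotProduct]
    exact Finset.single_le_sum (f := fun j => (B *ᵥ e t) j ^ 2)
      (fun j _ => sq_nonneg _) (Finset.mem_univ i)
  have hcont : Continuous fun v : Fin m → ℝ => norm2 (((Bᵀ * B)⁻¹ * Bᵀ) *ᵥ v) := by
    unfold norm2
    fun_prop
  have hlim := (hcont.tendsto 0).comp hBe
  have hrec : ∀ t, ((Bᵀ * B)⁻¹ * Bᵀ) *ᵥ (B *ᵥ e t) = e t := fun t => by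
    rw [mulVec_mulVec, Matrix.mul_assoc, nonsing_inv_mul _ hB, one_mulVec]
  simpa [Function.comp_def, -mulVec_mulVec, hrec, norm2] using hlim

/-- If `X` has rank `d` (with SVD `X = U D Vᵀ`), `S` is an `ε`-subspace embedding for `X`
with `ε < 1/2`, and `X̃ᵀ X̃` is invertible (`X̃ = S X`), then the iteration
`β^{(t+1)} = β^{(t)} + (X̃ᵀ X̃)⁻¹ Xᵀ (y − X β^{(t)})` converges to
`β_F = (Xᵀ X)⁻¹ Xᵀ y` for every starting value. -/
theorem lsIter_converges_of_subspaceEmbedding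
    (n d k : ℕ) (hd : 0 < d)
    (y : Fin n → ℝ)
    (X : Matrix (Fin n) (Fin d) ℝ) (hrank : X.rank = d)
    (U : Matrix (Fin n) (Fin d) ℝ) (σs : Fin d → ℝ) (V : Matrix (Fin d) (Fin d) ℝ)
    (hU : Uᵀ * U = 1) (hσ : ∀ i, 0 < σs i) (hV : Vᵀ * V = 1)
    (hX : X = U * Matrix.diagonal σs * Vᵀ)
    (S : Matrix (Fin k) (Fin n) ℝ) (ε : ℝ) (hε : 0 < ε) (hε2 : ε < 1 / 2)
    (hemb : IsSubspaceEmbedding S X ε)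
    (hinv : IsUnit ((S * X)ᵀ * (S * X)).det) :
    ∀ β0 : Fin d → ℝ,
      Tendsto (fun t : ℕ => norm2 (lsSol y X - (lsIter y X S)^[t] β0)) atTop (nhds 0) := by
  intro β0
  have hG := isUnit_det_transpose_mul_self_of_mul S X hinv
  apply tendsto_norm2_zero_of_energy (S * X) hinv
  set e : ℕ → Fin d → ℝ := fun t => lsSol y X - (lsIter y X S)^[t] β0 with he
  set q : ℝ := 1 - (1 - 2 * ε) / ((1 - ε) * (1 + ε)) with hq
  have hpos : 0 < (1 - ε) * (1 + ε) := by nlinarith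
  have hq0 : 0 ≤ q := by
    rw [hq, sub_nonneg, div_le_one hpos]
    nlinarith
  have hq1 : q < 1 := sub_lt_self _ (div_pos (by linarith) hpos)
  simp only [IsSubspaceEmbedding, sum_mulVec_sq_eq_dotProduct] at hemb
  have hstep : ∀ t, (S * X) *ᵥ e (t + 1) ⬝ᵥ (S * X) *ᵥ e (t + 1) ≤
      q * ((S * X) *ᵥ e t ⬝ᵥ (S * X) *ᵥ e t) := fun t => by
    have hrec : e (t + 1) =
        e t - ((S * X)ᵀ * (S * X))⁻¹ *ᵥ ((Xᵀ * X) *ᵥ e t) := by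
      simp only [he, Function.iterate_succ_apply']
      exact lsSol_sub_lsIter y X S hG _
    rw [hrec]
    refine energy_sub_le X (S * X) hε hε2 _ _ (hemb _).1 (hemb _).2 ?_
    rw [mulVec_mulVec, mul_nonsing_inv _ hinv, one_mulVec]
  have hgeom : ∀ t, (S * X) *ᵥ e t ⬝ᵥ (S * X) *ᵥ e t ≤
      q ^ t * ((S * X) *ᵥ e 0 ⬝ᵥ (S * X) *ᵥ e 0) := fun t => by
    induction t with
    | zero => simp
    | succ t ih =>
      rw [pow_succ', mul_assoc]
      exact (hstep t).trans (mul_le_mul_of_nonneg_left ih hq0)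
  refine squeeze_zero (fun t => ?_) hgeom ?_
  · rw [← sum_mulVec_sq_eq_dotProduct]
    positivity
  · simpa using (tendsto_pow_atTop_nhds_zero_of_lt_one hq0 hq1).mul_const _
end

section
/- Fix d and k with k ≥ d, let y ∈ ℝⁿ and let X be a real n×d matrix of rank d. Let S be a k×n random matrix whose entries are independent N(0, 1/k) random variables, and let G be a k×d random matrix whose entries are independent N(0, 1/k) random variables. Then the probability that the iteration β^{(t+1)} = β^{(t)} + (X̃ᵀX̃)^{-1}Xᵀ(y − Xβ^{(t)}) (with X̃ = SX) converges to β_F for all starting values equals Pr(λ_min(GᵀG) > 1/2); in particular this probability depends only on k and d and not on y, X, or n. -/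
open MeasureTheory ProbabilityTheory Matrix Filter
open scoped ENNReal NNReal

/-- Matrices inherit the product measurable structure. -/
instance {m n α : Type*} [MeasurableSpace α] : MeasurableSpace (Matrix m n α) :=
  inferInstanceAs (MeasurableSpace (m → n → α))

/-- The law of a `k × n` random matrix with independent `N(0, 1/k)` entries
(the Gaussian sketch of size `k`). -/
noncomputable def gaussianMatrix (k n : ℕ) : Measure (Matrix (Fin k) (Fin n) ℝ) :=
  Measure.pi fun _ : Fin k => Measure.pi fun _ : Fin n => gaussianReal 0 (1 / k)

/-- The smallest eigenvalue of a square real matrix. -/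
noncomputable def lambdaMin {d : ℕ} (M : Matrix (Fin d) (Fin d) ℝ) : ℝ :=
  sInf (spectrum ℝ M)

section GaussianInvariance

/-- Projecting an i.i.d. centred Gaussian vector onto an orthonormal family of directions
(the columns of `U`) gives an i.i.d. Gaussian vector with the same variance. -/
lemma map_vecMul_pi_gaussianReal {ι κ : Type*} [Fintype ι] [Fintype κ] [DecidableEq κ]
    (v : ℝ≥0) (U : Matrix ι κ ℝ) (hU : Uᵀ * U = 1) :
    (Measure.pi fun _ : ι => gaussianReal 0 v).map (fun x => x ᵥ* U) =
      Measure.pi fun _ : κ => gaussianReal 0 v := by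
  have hmeas : Measurable fun x : ι → ℝ => x ᵥ* U :=
    (Continuous.matrix_vecMul continuous_id continuous_const).measurable
  have := Measure.isProbabilityMeasure_map
    (μ := Measure.pi fun _ : ι => gaussianReal 0 v) hmeas.aemeasurable
  refine charFun_eq_pi_iff.1 fun t => ?_
  have hpull : charFun (((Measure.pi fun _ : ι => gaussianReal 0 v).map
      (fun x => x ᵥ* U)).map (WithLp.toLp 2)) t =
      charFun ((Measure.pi fun _ : ι => gaussianReal 0 v).map (WithLp.toLp 2))
        (WithLp.toLp 2 (U *ᵥ t.ofLp)) := by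
    rw [Measure.map_map (by fun_prop) hmeas, charFun_apply, charFun_apply,
      integral_map (by fun_prop) (by fun_prop), integral_map (by fun_prop) (by fun_prop)]
    refine integral_congr_ae (Eventually.of_forall fun x => ?_)
    have h : inner ℝ (WithLp.toLp 2 (x ᵥ* U)) t =
        inner ℝ (WithLp.toLp 2 x) (WithLp.toLp 2 (U *ᵥ t.ofLp)) := by
      simp only [EuclideanSpace.inner_eq_star_dotProduct, star_trivial]
      rw [dotProduct_comm, ← dotProduct_mulVec, dotProduct_comm]
    simp only [Function.comp_apply, h]
  have hsq : ∑ i, (U *ᵥ t.ofLp) i ^ 2 = ∑ j, t j ^ 2 := by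
    have h : (U *ᵥ t.ofLp) ⬝ᵥ (U *ᵥ t.ofLp) = t.ofLp ⬝ᵥ t.ofLp := by
      rw [dotProduct_mulVec, vecMul_mulVec, hU, vecMul_one]
    simpa [dotProduct, sq] using h
  rw [hpull, charFun_pi]
  simp only [charFun_gaussianReal, ← Complex.exp_sum]
  congr 1
  simp only [Complex.ofReal_zero, mul_zero, zero_mul, zero_sub, Finset.sum_neg_distrib,
    ← Finset.sum_div, ← Finset.mul_sum]
  exact_mod_cast congrArg (fun r : ℝ => -((v : ℝ) * r / 2)) hsq

lemma measurable_mul_const {k n d : ℕ} (U : Matrix (Fin n) (Fin d) ℝ) :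
    Measurable fun S : Matrix (Fin k) (Fin n) ℝ => S * U :=
  measurable_pi_iff.2 fun i => (Continuous.matrix_vecMul continuous_id
    (continuous_const (y := U))).measurable.comp (measurable_pi_apply i)

lemma gaussianMatrix_map_mul {k n d : ℕ} (U : Matrix (Fin n) (Fin d) ℝ) (hU : Uᵀ * U = 1) :
    (gaussianMatrix k n).map (fun S => S * U) = gaussianMatrix k d := by
  have hmeas : Measurable fun x : Fin n → ℝ => x ᵥ* U :=
    (Continuous.matrix_vecMul continuous_id continuous_const).measurable
  have hrow := map_vecMul_pi_gaussianReal (1 / (k : ℝ≥0)) U hU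
  have : SigmaFinite ((Measure.pi fun _ : Fin n => gaussianReal 0 (1 / (k : ℝ≥0))).map
      (fun x => x ᵥ* U)) := by rw [hrow]; infer_instance
  have h := Measure.pi_map_pi
    (μ := fun _ : Fin k => Measure.pi fun _ : Fin n => gaussianReal 0 (1 / (k : ℝ≥0)))
    (f := fun _ x => x ᵥ* U) (fun _ => hmeas.aemeasurable)
  simp only [hrow] at h
  exact h

end GaussianInvariance

section SmallestEigenvalue

lemma lt_lambdaMin_iff {d : ℕ} (hd : 0 < d) {M : Matrix (Fin d) (Fin d) ℝ}
    (hM : M.IsHermitian) (c : ℝ) : c < lambdaMin M ↔ ∀ i, c < hM.eigenvalues i := by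
  have : Nonempty (Fin d) := ⟨⟨0, hd⟩⟩
  have hfin := Set.finite_range hM.eigenvalues
  rw [lambdaMin, hM.spectrum_real_eq_range_eigenvalues]
  refine ⟨fun h i => h.trans_le (csInf_le hfin.bddBelow ⟨i, rfl⟩), fun h => ?_⟩
  obtain ⟨i, hi⟩ := (Set.range_nonempty hM.eigenvalues).csInf_mem hfin
  rw [← hi]
  exact h i

lemma isHermitian_transpose_mul_self_real {k d : ℕ} (G : Matrix (Fin k) (Fin d) ℝ) :
    (Gᵀ * G).IsHermitian := by
  simpa using isHermitian_conjTranspose_mul_self G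

lemma forall_le_eigenvalues_iff {d : ℕ} {M : Matrix (Fin d) (Fin d) ℝ}
    (hM : M.IsHermitian) (c : ℝ) :
    (∀ i, c ≤ hM.eigenvalues i) ↔ ∀ x : Fin d → ℝ, c * (x ⬝ᵥ x) ≤ x ⬝ᵥ (M *ᵥ x) := by
  have hherm : (M - algebraMap ℝ _ c).IsHermitian :=
    hM.sub (by simp [Matrix.algebraMap_eq_diagonal, IsHermitian])
  have hform (x : Fin d → ℝ) :
      x ⬝ᵥ ((M - algebraMap ℝ _ c) *ᵥ x) = x ⬝ᵥ (M *ᵥ x) - c * (x ⬝ᵥ x) := by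
    rw [Algebra.algebraMap_eq_smul_one, sub_mulVec, smul_mulVec, one_mulVec, dotProduct_sub,
      dotProduct_smul, smul_eq_mul]
  have h1 : (∀ i, c ≤ hM.eigenvalues i) ↔ (M - algebraMap ℝ _ c).PosSemidef := by
    rw [posSemidef_iff_isHermitian_and_spectrum_nonneg, ← spectrum.sub_singleton_eq,
      hM.spectrum_real_eq_range_eigenvalues]
    rw [and_iff_right hherm]
    simp [Set.subset_def]
  rw [h1, posSemidef_iff_dotProduct_mulVec, and_iff_right hherm]
  simp [hform]

lemma measurableSet_lt_lambdaMin {k d : ℕ} (hd : 0 < d) (c : ℝ) :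
    MeasurableSet {G : Matrix (Fin k) (Fin d) ℝ | c < lambdaMin (Gᵀ * G)} := by
  have hiff (G : Matrix (Fin k) (Fin d) ℝ) : c < lambdaMin (Gᵀ * G) ↔
      ∃ m : ℕ, ∀ x : Fin d → ℝ,
        (c + 1 / ((m : ℝ) + 1)) * (x ⬝ᵥ x) ≤ x ⬝ᵥ ((Gᵀ * G) *ᵥ x) := by
    have hG := isHermitian_transpose_mul_self_real G
    simp_rw [← forall_le_eigenvalues_iff hG]
    constructor
    · intro h
      obtain ⟨m, hm⟩ := exists_nat_one_div_lt (sub_pos.2 h)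
      refine ⟨m, fun i => ((lt_lambdaMin_iff hd hG _).1 ?_ i).le⟩
      linarith
    · rintro ⟨m, hm⟩
      refine (lt_lambdaMin_iff hd hG c).2 fun i => lt_of_lt_of_le ?_ (hm i)
      have : (0 : ℝ) < 1 / ((m : ℝ) + 1) := by positivity
      linarith
  have : BorelSpace (Matrix (Fin k) (Fin d) ℝ) :=
    inferInstanceAs (BorelSpace (Fin k → Fin d → ℝ))
  simp_rw [hiff]
  rw [Set.ofPred_exists]
  refine MeasurableSet.iUnion fun m => ?_
  rw [Set.ofPred_forall]
  refine (isClosed_iInter fun x => isClosed_le continuous_const ?_).measurableSet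
  exact Continuous.dotProduct continuous_const
    ((continuous_id.matrix_transpose.matrix_mul continuous_id).matrix_mulVec continuous_const)

end SmallestEigenvalue

section Convergence

lemma tendsto_norm2_zero_iff {d : ℕ} (f : ℕ → Fin d → ℝ) :
    Tendsto (fun t => norm2 (f t)) atTop (nhds 0) ↔ Tendsto f atTop (nhds 0) := by
  have h : ∀ t, norm2 (f t) = ‖WithLp.toLp 2 (f t)‖ := fun t => by
    simp [norm2, EuclideanSpace.norm_eq]
  simp_rw [h]
  rw [← tendsto_zero_iff_norm_tendsto_zero]
  constructor
  · intro h
    exact ((PiLp.continuous_ofLp 2 _).tendsto _).comp h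
  · intro h
    exact ((PiLp.continuous_toLp 2 _).tendsto _).comp h

lemma inv_mulVec_of_mulVec_eq_smul {d : ℕ} {M : Matrix (Fin d) (Fin d) ℝ}
    (hdet : IsUnit M.det) {v : Fin d → ℝ} {l : ℝ} (hl : l ≠ 0) (hv : M *ᵥ v = l • v) :
    M⁻¹ *ᵥ v = l⁻¹ • v := by
  have h : M⁻¹ *ᵥ (M *ᵥ v) = v := by rw [mulVec_mulVec, nonsing_inv_mul _ hdet, one_mulVec]
  rw [hv, mulVec_smul] at h
  rw [← h, smul_smul, inv_mul_cancel₀ hl, one_smul, h]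

lemma pow_mulVec_of_mulVec_eq_smul {d : ℕ} {T : Matrix (Fin d) (Fin d) ℝ}
    {v : Fin d → ℝ} {r : ℝ} (hv : T *ᵥ v = r • v) (t : ℕ) : T ^ t *ᵥ v = r ^ t • v := by
  induction t with
  | zero => simp
  | succ t ih => rw [pow_succ, ← mulVec_mulVec, hv, mulVec_smul, ih, smul_smul, pow_succ']

lemma abs_one_sub_inv_lt_one_iff {l : ℝ} (hl : 0 < l) : |1 - l⁻¹| < 1 ↔ 1 / 2 < l := by
  have h : l⁻¹ < 2 ↔ 1 / 2 < l := by
    rw [inv_lt_comm₀ hl two_pos, one_div]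
  have := inv_pos.2 hl
  rw [abs_lt, ← h]
  constructor
  · rintro ⟨h1, -⟩
    linarith
  · intro h1
    constructor <;> linarith

lemma eigenvectorBasis_ofLp_ne_zero {d : ℕ} {M : Matrix (Fin d) (Fin d) ℝ}
    (hM : M.IsHermitian) (i : Fin d) : (hM.eigenvectorBasis i).ofLp ≠ 0 := fun h =>
  hM.eigenvectorBasis.orthonormal.ne_zero i ((WithLp.ofLp_eq_zero 2).1 h)

/-- For a Gram matrix `M = Gᵀ G`, the powers of `1 - M⁻¹` tend to zero (with `M` invertible)
exactly when all eigenvalues of `M` exceed `1/2`. -/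
lemma isUnit_and_tendsto_pow_iff {k d : ℕ} (hd : 0 < d) (G : Matrix (Fin k) (Fin d) ℝ) :
    (IsUnit (Gᵀ * G).det ∧ ∀ v : Fin d → ℝ,
      Tendsto (fun t : ℕ => (1 - (Gᵀ * G)⁻¹) ^ t *ᵥ v) atTop (nhds 0)) ↔
      1 / 2 < lambdaMin (Gᵀ * G) := by
  have hM := isHermitian_transpose_mul_self_real G
  have hpsd : (Gᵀ * G).PosSemidef := by simpa using posSemidef_conjTranspose_mul_self G
  have hstep (hdet : IsUnit (Gᵀ * G).det) (i) (hi : hM.eigenvalues i ≠ 0) (t : ℕ) :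
      (1 - (Gᵀ * G)⁻¹) ^ t *ᵥ (hM.eigenvectorBasis i).ofLp =
        (1 - (hM.eigenvalues i)⁻¹) ^ t • (hM.eigenvectorBasis i).ofLp := by
    refine pow_mulVec_of_mulVec_eq_smul ?_ t
    rw [sub_mulVec, one_mulVec,
      inv_mulVec_of_mulVec_eq_smul hdet hi (hM.mulVec_eigenvectorBasis i), sub_smul, one_smul]
  have hprod : (Gᵀ * G).det = ∏ i, hM.eigenvalues i := by
    simpa using hM.det_eq_prod_eigenvalues
  rw [lt_lambdaMin_iff hd hM]
  constructor
  · rintro ⟨hdet, hconv⟩ i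
    have hne : hM.eigenvalues i ≠ 0 := fun h =>
      hdet.ne_zero (hprod.trans (Finset.prod_eq_zero (Finset.mem_univ i) h))
    refine (abs_one_sub_inv_lt_one_iff ((hpsd.eigenvalues_nonneg i).lt_of_ne' hne)).1 ?_
    obtain ⟨j, hj⟩ := Function.ne_iff.1 (eigenvectorBasis_ofLp_ne_zero hM i)
    have h := tendsto_pi_nhds.1 (hconv (hM.eigenvectorBasis i).ofLp) j
    simp only [hstep hdet i hne, Pi.smul_apply, smul_eq_mul, Pi.zero_apply] at h
    have h2 := h.mul_const ((hM.eigenvectorBasis i).ofLp j)⁻¹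
    simp only [mul_assoc, mul_inv_cancel₀ hj, mul_one, zero_mul] at h2
    exact tendsto_pow_atTop_nhds_zero_iff.1 h2
  · intro h
    have hpos : ∀ i, 0 < hM.eigenvalues i := fun i => lt_trans (by norm_num) (h i)
    have hdet : IsUnit (Gᵀ * G).det := by
      rw [hprod]
      exact (Finset.prod_pos fun i _ => hpos i).ne'.isUnit
    refine ⟨hdet, fun v => ?_⟩
    have hv : v = ∑ i, hM.eigenvectorBasis.repr (WithLp.toLp 2 v) i •
        (hM.eigenvectorBasis i).ofLp := by
      have := congrArg WithLp.ofLp (hM.eigenvectorBasis.sum_repr (WithLp.toLp 2 v))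
      simpa using this.symm
    have hexp (t : ℕ) : (1 - (Gᵀ * G)⁻¹) ^ t *ᵥ v =
        ∑ i, (1 - (hM.eigenvalues i)⁻¹) ^ t • hM.eigenvectorBasis.repr (WithLp.toLp 2 v) i •
          (hM.eigenvectorBasis i).ofLp := by
      conv_lhs => rw [hv]
      rw [mulVec_sum]
      refine Finset.sum_congr rfl fun i _ => ?_
      rw [mulVec_smul, hstep hdet i (hpos i).ne', smul_comm]
    simp_rw [hexp]
    have hsum : (0 : Fin d → ℝ) = ∑ _i : Fin d, (0 : Fin d → ℝ) := by simp
    rw [hsum]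
    refine tendsto_finsetSum _ fun i _ => ?_
    have := (tendsto_pow_atTop_nhds_zero_iff.2
      ((abs_one_sub_inv_lt_one_iff (hpos i)).2 (h i))).smul_const
        (hM.eigenvectorBasis.repr (WithLp.toLp 2 v) i • (hM.eigenvectorBasis i).ofLp)
    simpa only [zero_smul] using this

/-- A matrix of full column rank factors as `X = U B` with orthonormal columns in `U` and `B`
invertible. -/
lemma exists_orthonormal_mul_of_rank_eq {n d : ℕ} (X : Matrix (Fin n) (Fin d) ℝ)
    (hrank : X.rank = d) :
    ∃ (U : Matrix (Fin n) (Fin d) ℝ) (B : Matrix (Fin d) (Fin d) ℝ),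
      Uᵀ * U = 1 ∧ IsUnit B.det ∧ X = U * B := by
  have hr : (Xᵀ * X).rank = d := by rw [rank_transpose_mul_self, hrank]
  have hunit : IsUnit (Xᵀ * X) := by
    rw [← mulVec_surjective_iff_isUnit]
    have : LinearMap.range (Xᵀ * X).mulVecLin = ⊤ :=
      Submodule.eq_top_of_finrank_eq (by simpa [Matrix.rank] using hr)
    exact LinearMap.range_eq_top.1 this
  have hpsd : (Xᵀ * X).PosSemidef := by simpa using posSemidef_conjTranspose_mul_self X
  obtain ⟨B, hB⟩ : ∃ B : Matrix (Fin d) (Fin d) ℝ, Xᵀ * X = Bᵀ * B := by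
    open scoped MatrixOrder Matrix.Norms.L2Operator in
    obtain ⟨B, hB⟩ := CStarAlgebra.nonneg_iff_eq_star_mul_self.1 hpsd.nonneg
    exact ⟨B, by simpa [star_eq_conjTranspose] using hB⟩
  have hBdet : IsUnit B.det := by
    have := (isUnit_iff_isUnit_det _).1 hunit
    rw [hB, det_mul] at this
    exact isUnit_of_mul_isUnit_right this
  refine ⟨X * B⁻¹, B, ?_, hBdet, ?_⟩
  · have hBt : IsUnit Bᵀ.det := by rwa [det_transpose]
    rw [transpose_mul, transpose_nonsing_inv, Matrix.mul_assoc, ← Matrix.mul_assoc Xᵀ, hB,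
      Matrix.mul_assoc, mul_nonsing_inv _ hBdet, Matrix.mul_one, nonsing_inv_mul _ hBt]
  · rw [Matrix.mul_assoc, nonsing_inv_mul _ hBdet, Matrix.mul_one]

/-- In the coordinates given by `B`, where `X = U B`, the error of the iteration is multiplied by
`1 - (Gᵀ G)⁻¹` in each step, with `G = S U`. -/
lemma mulVec_lsSol_sub_lsIter_iterate {n d k : ℕ} (y : Fin n → ℝ)
    {U : Matrix (Fin n) (Fin d) ℝ} {B : Matrix (Fin d) (Fin d) ℝ}
    (hU : Uᵀ * U = 1) (hB : IsUnit B.det) (S : Matrix (Fin k) (Fin n) ℝ) (β : Fin d → ℝ)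
    (t : ℕ) :
    B *ᵥ (lsSol y (U * B) - (lsIter y (U * B) S)^[t] β) =
      (1 - ((S * U)ᵀ * (S * U))⁻¹) ^ t *ᵥ (B *ᵥ (lsSol y (U * B) - β)) := by
  have hBt : IsUnit Bᵀ.det := by rwa [det_transpose]
  have hXX : (U * B)ᵀ * (U * B) = Bᵀ * B := by
    rw [transpose_mul, Matrix.mul_assoc, ← Matrix.mul_assoc Uᵀ, hU, Matrix.one_mul]
  have hnormal : (U * B)ᵀ *ᵥ y = (Bᵀ * B) *ᵥ lsSol y (U * B) := by
    rw [lsSol, hXX, mulVec_mulVec, ← Matrix.mul_assoc, mul_nonsing_inv, Matrix.one_mul]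
    rw [det_mul]
    exact hBt.mul hB
  have hinv : B * ((S * (U * B))ᵀ * (S * (U * B)))⁻¹ * (Bᵀ * B) =
      ((S * U)ᵀ * (S * U))⁻¹ * B := by
    have h : (S * (U * B))ᵀ * (S * (U * B)) = Bᵀ * ((S * U)ᵀ * (S * U)) * B := by
      simp only [transpose_mul, Matrix.mul_assoc]
    rw [h, Matrix.mul_inv_rev, Matrix.mul_inv_rev, ← Matrix.mul_assoc B, mul_nonsing_inv _ hB, Matrix.one_mul,
      Matrix.mul_assoc, ← Matrix.mul_assoc _ Bᵀ, nonsing_inv_mul _ hBt, Matrix.one_mul]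
  have hstep (γ : Fin d → ℝ) : B *ᵥ (lsSol y (U * B) - lsIter y (U * B) S γ) =
      (1 - ((S * U)ᵀ * (S * U))⁻¹) *ᵥ (B *ᵥ (lsSol y (U * B) - γ)) := by
    rw [lsIter, mulVec_sub (U * B)ᵀ, hnormal, mulVec_mulVec γ, hXX, ← mulVec_sub, ← sub_sub,
      mulVec_sub B (_ - γ), mulVec_mulVec, mulVec_mulVec, hinv, sub_mulVec, one_mulVec,
      mulVec_mulVec]
  induction t with
  | zero => simp
  | succ t ih =>
    rw [Function.iterate_succ_apply', hstep, ih, mulVec_mulVec, ← pow_succ']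

lemma convergence_iff_lt_lambdaMin {n d k : ℕ} (hd : 0 < d) (y : Fin n → ℝ)
    {U : Matrix (Fin n) (Fin d) ℝ} {B : Matrix (Fin d) (Fin d) ℝ}
    (hU : Uᵀ * U = 1) (hB : IsUnit B.det) (S : Matrix (Fin k) (Fin n) ℝ) :
    (IsUnit ((S * (U * B))ᵀ * (S * (U * B))).det ∧ ∀ β0 : Fin d → ℝ,
      Tendsto (fun t : ℕ => norm2 (lsSol y (U * B) - (lsIter y (U * B) S)^[t] β0))
        atTop (nhds 0)) ↔ 1 / 2 < lambdaMin ((S * U)ᵀ * (S * U)) := by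
  rw [← isUnit_and_tendsto_pow_iff hd]
  have hdet : IsUnit ((S * (U * B))ᵀ * (S * (U * B))).det ↔
      IsUnit ((S * U)ᵀ * (S * U)).det := by
    have h : (S * (U * B))ᵀ * (S * (U * B)) = Bᵀ * ((S * U)ᵀ * (S * U)) * B := by
      simp only [transpose_mul, Matrix.mul_assoc]
    rw [h, det_mul, det_mul, det_transpose]
    simp only [IsUnit.mul_iff, hB, true_and, and_true]
  have hcancel (v : Fin d → ℝ) : B⁻¹ *ᵥ (B *ᵥ v) = v := by
    rw [mulVec_mulVec, nonsing_inv_mul _ hB, one_mulVec]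
  have hcancel' (v : Fin d → ℝ) : B *ᵥ (B⁻¹ *ᵥ v) = v := by
    rw [mulVec_mulVec, mul_nonsing_inv _ hB, one_mulVec]
  have htend (A : Matrix (Fin d) (Fin d) ℝ) (f : ℕ → Fin d → ℝ)
      (hf : Tendsto f atTop (nhds 0)) : Tendsto (fun t => A *ᵥ f t) atTop (nhds 0) := by
    have hc : Continuous fun x : Fin d → ℝ => A *ᵥ x :=
      continuous_const.matrix_mulVec continuous_id
    simpa only [mulVec_zero, Function.comp_def] using (hc.tendsto 0).comp hf
  rw [hdet]
  refine and_congr_right fun _ => ?_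
  simp_rw [tendsto_norm2_zero_iff]
  constructor
  · intro h v
    have := htend B _ (h (lsSol y (U * B) - B⁻¹ *ᵥ v))
    simpa only [mulVec_lsSol_sub_lsIter_iterate y hU hB, sub_sub_cancel, hcancel'] using this
  · intro h β
    have := htend B⁻¹ _ (h (B *ᵥ (lsSol y (U * B) - β)))
    simpa only [← mulVec_lsSol_sub_lsIter_iterate y hU hB, hcancel] using this

end Convergence

/-- For a Gaussian sketch `S` of size `k ≥ d`, the probability that the preconditioned
iteration `β^{(t+1)} = β^{(t)} + (X̃ᵀ X̃)⁻¹ Xᵀ (y − X β^{(t)})` (with `X̃ = S X`, declared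
non-convergent when `X̃ᵀ X̃` is singular) converges to `β_F` for all starting values equals
`Pr(λ_min(Gᵀ G) > 1/2)` with `G` a `k × d` matrix of independent `N(0, 1/k)` entries; in
particular it depends only on `k` and `d`, not on `y`, `X` or `n`. -/
theorem gaussian_sketch_convergence_probability
    (n d k : ℕ) (hn : 0 < n) (hd : 0 < d) (hk : d ≤ k)
    (y : Fin n → ℝ) (X : Matrix (Fin n) (Fin d) ℝ) (hrank : X.rank = d) :
    gaussianMatrix k n
        {S | IsUnit ((S * X)ᵀ * (S * X)).det ∧
          ∀ β0 : Fin d → ℝ,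
            Tendsto (fun t : ℕ => norm2 (lsSol y X - (lsIter y X S)^[t] β0)) atTop (nhds 0)} =
      gaussianMatrix k d {G | 1 / 2 < lambdaMin (Gᵀ * G)} := by
  obtain ⟨U, B, hU, hB, rfl⟩ := exists_orthonormal_mul_of_rank_eq X hrank
  rw [← gaussianMatrix_map_mul U hU,
    Measure.map_apply (measurable_mul_const U) (measurableSet_lt_lambdaMin hd _)]
  congr 1
  ext S
  exact convergence_iff_lt_lambdaMin hd y hU hB S
end

section
/- For each m, let G_m be a k_m × d_m random matrix whose entries are independent N(0, 1/k_m) random variables, where d_m ≤ k_m, d_m → ∞, k_m → ∞, and d_m/k_m → α with α ∈ (0, 1]. Then the smallest eigenvalue λ_min(G_mᵀG_m) converges in probability to (1 − √α)². -/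
open MeasureTheory ProbabilityTheory Matrix Filter
open scoped ENNReal NNReal

/-- The largest eigenvalue of a square real matrix. -/
noncomputable def lambdaMax {d : ℕ} (M : Matrix (Fin d) (Fin d) ℝ) : ℝ :=
  sSup (spectrum ℝ M)

section Chernoff

lemma one_le_one_sub_mul_exp {u : ℝ} (hu : |u| ≤ 1 / 4) :
    1 ≤ (1 - 2 * u) * Real.exp (2 * u + 4 * u ^ 2) := by
  obtain ⟨h1, h2⟩ := abs_le.1 hu
  rcases le_total 0 u with h | h
  · have h3 := Real.quadratic_le_exp_of_nonneg (x := 2 * u + 4 * u ^ 2) (by positivity)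
    have h4 : (1 - 2 * u) * (1 + (2 * u + 4 * u ^ 2) + (2 * u + 4 * u ^ 2) ^ 2 / 2) ≤
        (1 - 2 * u) * Real.exp (2 * u + 4 * u ^ 2) :=
      mul_le_mul_of_nonneg_left h3 (by linarith)
    refine le_trans ?_ h4
    have h5 : 0 ≤ (1 - 4 * u ^ 2) * (1 + 2 * u) - 4 * u := by
      nlinarith [mul_nonneg h (by linarith : 0 ≤ 1 / 4 - u),
        mul_nonneg (mul_nonneg h h) (by linarith : 0 ≤ 1 / 4 - u)]
    nlinarith [mul_nonneg (mul_nonneg h h) h5]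
  · have h3 := Real.add_one_le_exp (2 * u + 4 * u ^ 2)
    have h4 : (1 - 2 * u) * (2 * u + 4 * u ^ 2 + 1) ≤
        (1 - 2 * u) * Real.exp (2 * u + 4 * u ^ 2) :=
      mul_le_mul_of_nonneg_left h3 (by linarith)
    refine le_trans ?_ h4
    nlinarith [mul_nonneg (sq_nonneg u) (by linarith : 0 ≤ -u)]

variable {v : ℝ≥0} {u : ℝ}

lemma gaussianPDFReal_mul_exp_sq (hv : v ≠ 0) (x : ℝ) :
    gaussianPDFReal 0 v x * Real.exp (u / v * x ^ 2) =
      (√(2 * Real.pi * v))⁻¹ * Real.exp (-((1 - 2 * u) / (2 * v)) * x ^ 2) := by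
  have : (v : ℝ) ≠ 0 := by exact_mod_cast hv
  rw [gaussianPDFReal, mul_assoc, ← Real.exp_add]
  congr 2
  field_simp
  ring

lemma integrable_exp_sq_gaussianReal (hv : v ≠ 0) (hu : |u| ≤ 1 / 4) :
    Integrable (fun x => Real.exp (u / v * x ^ 2)) (gaussianReal 0 v) := by
  have hv' : (0 : ℝ) < v := by exact_mod_cast pos_iff_ne_zero.2 hv
  have hu' := (abs_le.1 hu).2
  rw [gaussianReal_of_var_ne_zero _ hv,
    integrable_withDensity_iff_integrable_smul' (measurable_gaussianPDF _ _)
      (ae_of_all _ fun _ => gaussianPDF_lt_top)]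
  simp only [toReal_gaussianPDF, smul_eq_mul, gaussianPDFReal_mul_exp_sq hv]
  exact (integrable_exp_neg_mul_sq (div_pos (by linarith) (by linarith))).const_mul _

lemma integral_exp_sq_gaussianReal_le (hv : v ≠ 0) (hu : |u| ≤ 1 / 4) :
    ∫ x, Real.exp (u / v * x ^ 2) ∂gaussianReal 0 v ≤ Real.exp (u + 2 * u ^ 2) := by
  have hv' : (0 : ℝ) < v := by exact_mod_cast pos_iff_ne_zero.2 hv
  have hu' := (abs_le.1 hu).2
  have h1 : 0 < 1 - 2 * u := by linarith
  rw [integral_gaussianReal_eq_integral_smul hv]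
  simp only [smul_eq_mul, gaussianPDFReal_mul_exp_sq hv]
  rw [integral_const_mul, integral_gaussian, ← Real.sqrt_inv, ← Real.sqrt_mul (by positivity)]
  apply Real.sqrt_le_iff.2 ⟨(Real.exp_pos _).le, ?_⟩
  rw [← Real.exp_nat_mul]
  have e : (2 * Real.pi * v)⁻¹ * (Real.pi / ((1 - 2 * u) / (2 * v))) = (1 - 2 * u)⁻¹ := by
    have := Real.pi_pos.ne'
    field_simp
  rw [e, inv_le_iff_one_le_mul₀' h1]
  have e2 : ((2 : ℕ) : ℝ) * (u + 2 * u ^ 2) = 2 * u + 4 * u ^ 2 := by push_cast; ring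
  rw [e2]
  exact one_le_one_sub_mul_exp hu

lemma integrable_exp_sum_sq (hv : v ≠ 0) (hu : |u| ≤ 1 / 4) (j : ℕ) :
    Integrable (fun x : Fin j → ℝ => Real.exp (u / v * (x ⬝ᵥ x)))
      (Measure.pi fun _ => gaussianReal 0 v) := by
  have := Integrable.fintype_prod (μ := fun _ : Fin j => gaussianReal 0 v)
    (fun _ => integrable_exp_sq_gaussianReal hv hu)
  simpa only [← Real.exp_sum, ← Finset.mul_sum, dotProduct, pow_two] using this

lemma mgf_sum_sq_le (hv : v ≠ 0) (hu : |u| ≤ 1 / 4) (j : ℕ) :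
    mgf (fun x : Fin j → ℝ => x ⬝ᵥ x) (Measure.pi fun _ => gaussianReal 0 v) (u / v) ≤
      Real.exp (j * (u + 2 * u ^ 2)) := by
  have h := integral_fintype_prod_eq_pow (ι := Fin j) (μ := gaussianReal 0 v)
    (fun x => Real.exp (u / v * x ^ 2))
  simp only [← Real.exp_sum, ← Finset.mul_sum, Fintype.card_fin] at h
  have e : mgf (fun x : Fin j → ℝ => x ⬝ᵥ x) (Measure.pi fun _ => gaussianReal 0 v) (u / v) =
      (∫ x, Real.exp (u / v * x ^ 2) ∂gaussianReal 0 v) ^ j := by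
    rw [← h, mgf]
    simp only [dotProduct, pow_two]
  rw [e, Real.exp_nat_mul]
  gcongr
  exact integral_exp_sq_gaussianReal_le hv hu

/-- Chernoff bound for the squared norm of a Gaussian vector with covariance `I / K`. -/
lemma measure_abs_sum_sq_sub_gt_le {K j : ℕ} (hK : 0 < K) (hj : j ≤ K) {ε : ℝ} (hε : 0 < ε)
    (hε1 : ε ≤ 1) :
    (Measure.pi fun _ : Fin j => gaussianReal 0 (1 / K)) {x | ε < |x ⬝ᵥ x - j / K|} ≤
      ENNReal.ofReal (2 * Real.exp (-(ε ^ 2 / 8) * K)) := by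
  set μ := Measure.pi fun _ : Fin j => gaussianReal 0 (1 / K)
  have hK' : (0 : ℝ) < K := by exact_mod_cast hK
  have hjK : (j : ℝ) ≤ K := by exact_mod_cast hj
  have hv : (1 / K : ℝ≥0) ≠ 0 := by positivity
  have hv' : ((1 / K : ℝ≥0) : ℝ) = 1 / K := by push_cast; rfl
  have hu : |ε / 4| ≤ 1 / 4 := by rw [abs_of_pos (by positivity)]; linarith
  have hu' : |-(ε / 4)| ≤ 1 / 4 := by rwa [abs_neg]
  have i1 := integrable_exp_sum_sq hv hu j
  have i2 := integrable_exp_sum_sq hv hu' j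
  have m1 := mgf_sum_sq_le hv hu j
  have m2 := mgf_sum_sq_le hv hu' j
  rw [hv'] at i1 i2 m1 m2
  have p1 : 0 ≤ ε / 4 / (1 / (K : ℝ)) := by positivity
  have p2 : -(ε / 4) / (1 / (K : ℝ)) ≤ 0 := by
    rw [neg_div]; exact neg_nonpos.2 p1
  have b1 := measure_ge_le_exp_mul_mgf (X := fun x : Fin j → ℝ => x ⬝ᵥ x) (μ := μ)
    (j / K + ε) p1 i1
  have b2 := measure_le_le_exp_mul_mgf (X := fun x : Fin j → ℝ => x ⬝ᵥ x) (μ := μ)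
    (j / K - ε) p2 i2
  have hsq : ε ^ 2 * j ≤ ε ^ 2 * K := by gcongr
  have c1 : μ.real {x | j / K + ε ≤ x ⬝ᵥ x} ≤ Real.exp (-(ε ^ 2 / 8) * K) := by
    refine b1.trans ((mul_le_mul_of_nonneg_left m1 (Real.exp_pos _).le).trans ?_)
    rw [← Real.exp_add, Real.exp_le_exp]
    have : -(ε / 4 / (1 / (K : ℝ))) * (j / K + ε) = -(ε / 4 * j) - ε ^ 2 / 4 * K := by
      field_simp
      ring
    rw [this]
    nlinarith
  have c2 : μ.real {x | x ⬝ᵥ x ≤ j / K - ε} ≤ Real.exp (-(ε ^ 2 / 8) * K) := by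
    refine b2.trans ((mul_le_mul_of_nonneg_left m2 (Real.exp_pos _).le).trans ?_)
    rw [← Real.exp_add, Real.exp_le_exp]
    have : -(-(ε / 4) / (1 / (K : ℝ))) * (j / K - ε) = ε / 4 * j - ε ^ 2 / 4 * K := by
      field_simp
    rw [this]
    nlinarith
  rw [← ofReal_measureReal]
  apply ENNReal.ofReal_le_ofReal
  have hsub : {x : Fin j → ℝ | ε < |x ⬝ᵥ x - j / K|} ⊆
      {x | j / K + ε ≤ x ⬝ᵥ x} ∪ {x | x ⬝ᵥ x ≤ j / K - ε} := by
    intro x hx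
    rcases lt_abs.1 (show ε < |x ⬝ᵥ x - j / K| from hx) with h | h
    · left; simp only [Set.mem_ofPred_eq]; linarith
    · right; simp only [Set.mem_ofPred_eq]; linarith
  calc μ.real _ ≤ μ.real ({x | j / K + ε ≤ x ⬝ᵥ x} ∪ {x | x ⬝ᵥ x ≤ j / K - ε}) :=
        measureReal_mono hsub
    _ ≤ _ := measureReal_union_le _ _
    _ ≤ _ := by linarith

end Chernoff

section Householder

variable {p q : ℕ}

/-- The Householder reflection mapping `g` to `‖g‖ e₀`. -/
noncomputable def householder (g : Fin (p + 1) → ℝ) : Matrix (Fin (p + 1)) (Fin (p + 1)) ℝ :=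
  let w := g - Pi.single 0 (√(g ⬝ᵥ g))
  1 - (2 / (w ⬝ᵥ w)) • vecMulVec w w

lemma householder_transpose (g : Fin (p + 1) → ℝ) : (householder g)ᵀ = householder g := by
  simp [householder, transpose_sub, transpose_vecMulVec]

lemma householder_mulVec (g x : Fin (p + 1) → ℝ) :
    householder g *ᵥ x = x - (2 / ((g - Pi.single 0 (√(g ⬝ᵥ g))) ⬝ᵥ
      (g - Pi.single 0 (√(g ⬝ᵥ g)))) * ((g - Pi.single 0 (√(g ⬝ᵥ g))) ⬝ᵥ x)) •
        (g - Pi.single 0 (√(g ⬝ᵥ g))) := by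
  simp only [householder, sub_mulVec, one_mulVec, smul_mulVec, vecMulVec_mulVec,
    op_smul_eq_smul, smul_smul]

lemma dotProduct_self_nonneg_real {n : ℕ} (x : Fin n → ℝ) : 0 ≤ x ⬝ᵥ x :=
  Finset.sum_nonneg fun _ _ => mul_self_nonneg _

lemma householder_dotProduct (g x y : Fin (p + 1) → ℝ) :
    (householder g *ᵥ x) ⬝ᵥ (householder g *ᵥ y) = x ⬝ᵥ y := by
  rw [householder_mulVec, householder_mulVec]
  set w := g - Pi.single 0 (√(g ⬝ᵥ g))
  by_cases hw : w ⬝ᵥ w = 0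
  · simp [hw]
  · simp only [sub_dotProduct, dotProduct_sub, smul_dotProduct, dotProduct_smul, smul_eq_mul]
    rw [dotProduct_comm x w]
    field_simp
    ring

lemma householder_mulVec_self (g : Fin (p + 1) → ℝ) :
    householder g *ᵥ g = Pi.single 0 (√(g ⬝ᵥ g)) := by
  rw [householder_mulVec]
  set w := g - Pi.single 0 (√(g ⬝ᵥ g)) with hw
  by_cases h : w ⬝ᵥ w = 0
  · rw [dotProduct_self_eq_zero] at h
    rw [h]
    simpa [sub_eq_zero, hw] using h
  · have e : w ⬝ᵥ w = 2 * (w ⬝ᵥ g) := by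
      have hs := Real.mul_self_sqrt (dotProduct_self_nonneg_real g)
      simp only [hw, sub_dotProduct, dotProduct_sub, single_dotProduct, dotProduct_single,
        Pi.sub_apply, Pi.single_eq_same]
      linear_combination hs
    have : 2 / (w ⬝ᵥ w) * (w ⬝ᵥ g) = 1 := by
      rw [div_mul_eq_mul_div, ← e, div_self h]
    rw [this, one_smul, hw, sub_sub_cancel]

lemma measurable_householder : Measurable (householder (p := p)) := by
  refine measurable_pi_lambda _ fun i => measurable_pi_lambda _ fun j => ?_
  have hs : ∀ i, Measurable fun g : Fin (p + 1) → ℝ =>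
      (g - Pi.single 0 (√(g ⬝ᵥ g)) : Fin (p + 1) → ℝ) i := by
    intro i
    simp only [Pi.sub_apply, Pi.single_apply, dotProduct]
    split_ifs <;> fun_prop
  simp only [householder, Matrix.sub_apply, Matrix.smul_apply, vecMulVec_apply, smul_eq_mul]
  simp only [dotProduct] at hs ⊢
  have h2 : Measurable fun g : Fin (p + 1) → ℝ => ∑ i,
      (g - Pi.single 0 (√(∑ i, g i * g i)) : Fin (p + 1) → ℝ) i *
      (g - Pi.single 0 (√(∑ i, g i * g i)) : Fin (p + 1) → ℝ) i :=
    Finset.measurable_sum _ fun i _ => (hs i).mul (hs i)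
  exact measurable_const.sub ((measurable_const.div h2).mul ((hs i).mul (hs j)))

end Householder

section Invariance

/-- The product Gaussian measure is invariant under norm-preserving linear maps. -/
lemma measurePreserving_mulVec_gaussian {n : ℕ} (v : ℝ≥0) (H : Matrix (Fin n) (Fin n) ℝ)
    (hH : ∀ x, (H *ᵥ x) ⬝ᵥ (H *ᵥ x) = x ⬝ᵥ x) :
    MeasurePreserving (fun x => H *ᵥ x) (Measure.pi fun _ : Fin n => gaussianReal 0 v)
      (Measure.pi fun _ : Fin n => gaussianReal 0 v) := by
  have hm : Measurable fun x : Fin n → ℝ => H *ᵥ x := by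
    refine measurable_pi_lambda _ fun i => ?_
    simp only [mulVec, dotProduct]
    fun_prop
  have hstd : MeasurePreserving (fun x => H *ᵥ x) (Measure.pi fun _ : Fin n => gaussianReal 0 1)
      (Measure.pi fun _ : Fin n => gaussianReal 0 1) := by
    refine ⟨hm, ?_⟩
    let f : EuclideanSpace ℝ (Fin n) →ₗᵢ[ℝ] EuclideanSpace ℝ (Fin n) :=
      { toLinearMap := Matrix.toEuclideanLin H
        norm_map' := fun x => by
          have h := hH x.ofLp
          rw [EuclideanSpace.norm_eq, EuclideanSpace.norm_eq]
          congr 1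
          simpa [dotProduct, pow_two] using h }
    have h1 := stdGaussian_map (f.toLinearIsometryEquiv rfl)
    rw [← map_pi_eq_stdGaussian, Measure.map_map (by fun_prop) (by fun_prop)] at h1
    have h2 := congrArg (Measure.map (WithLp.ofLp (p := 2))) h1
    rw [Measure.map_map (by fun_prop) (by fun_prop),
      Measure.map_map (by fun_prop) (by fun_prop)] at h2
    have e2 : (WithLp.ofLp (p := 2) ∘ WithLp.toLp 2 : (Fin n → ℝ) → _) = id := rfl
    rw [e2, Measure.map_id] at h2
    exact h2
  have hscale : MeasurePreserving (fun (x : Fin n → ℝ) i => (NNReal.sqrt v : ℝ) * x i)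
      (Measure.pi fun _ : Fin n => gaussianReal 0 1)
      (Measure.pi fun _ : Fin n => gaussianReal 0 v) := by
    refine measurePreserving_pi _ _ fun _ => ⟨by fun_prop, ?_⟩
    rw [gaussianReal_map_const_mul]
    congr 1
    · simp
    · ext; simp [Real.sq_sqrt]
  refine ⟨hm, ?_⟩
  conv_lhs => rw [← hscale.map_eq]
  rw [Measure.map_map hm hscale.measurable]
  have e : (fun x => H *ᵥ x) ∘ (fun (x : Fin n → ℝ) i => (NNReal.sqrt v : ℝ) * x i) =
      (fun (x : Fin n → ℝ) i => (NNReal.sqrt v : ℝ) * x i) ∘ (fun x => H *ᵥ x) := by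
    funext x
    exact mulVec_smul H (NNReal.sqrt v : ℝ) x
  rw [e]
  exact (hscale.comp hstd).map_eq

/-- The law of a random matrix with independent `N(0, v)` entries. -/
noncomputable def gaussianMatrixVar (v : ℝ≥0) (p q : ℕ) : Measure (Matrix (Fin p) (Fin q) ℝ) :=
  Measure.pi fun _ : Fin p => Measure.pi fun _ : Fin q => gaussianReal 0 v

instance (v : ℝ≥0) (p q : ℕ) : IsProbabilityMeasure (gaussianMatrixVar v p q) :=
  inferInstanceAs (IsProbabilityMeasure
    (Measure.pi fun _ : Fin p => Measure.pi fun _ : Fin q => gaussianReal 0 v))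

lemma measurePreserving_transpose_gaussianMatrixVar (v : ℝ≥0) (p q : ℕ) :
    MeasurePreserving (transpose : Matrix (Fin p) (Fin q) ℝ → Matrix (Fin q) (Fin p) ℝ)
      (gaussianMatrixVar v p q) (gaussianMatrixVar v q p) := by
  have key : ∀ p q : ℕ, MeasurePreserving (MeasurableEquiv.curry (Fin p) (Fin q) ℝ)
      (Measure.pi fun _ : Fin p × Fin q => gaussianReal 0 v)
      (Measure.pi fun _ : Fin p => Measure.pi fun _ : Fin q => gaussianReal 0 v) := by
    intro p q
    refine ⟨MeasurableEquiv.measurable _, ?_⟩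
    have := Measure.infinitePi_map_curry (fun (_ : Fin p) (_ : Fin q) => gaussianReal 0 v)
    simpa only [Measure.infinitePi_eq_pi] using this
  have hswap := measurePreserving_piCongrLeft (fun _ : Fin q × Fin p => gaussianReal 0 v)
    (Equiv.prodComm (Fin p) (Fin q))
  have h := (key q p).comp (hswap.comp (key p q).symm)
  exact h

end Invariance

section Step

variable {p q : ℕ}

/-- One half of a Householder bidiagonalization step on a matrix whose rows are the vectors to be
reflected: reflect the remaining rows so that row `0` becomes a multiple of `e₀`, then transpose. -/
noncomputable def reflectRest (C : Matrix (Fin (q + 1)) (Fin (p + 1)) ℝ) :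
    Matrix (Fin (p + 1)) (Fin q) ℝ :=
  (Matrix.of fun j : Fin q => householder (C 0) *ᵥ C j.succ)ᵀ

lemma measurePreserving_reflectRest (v : ℝ≥0) (p q : ℕ) :
    MeasurePreserving (reflectRest (p := p) (q := q))
      (gaussianMatrixVar v (q + 1) (p + 1)) (gaussianMatrixVar v (p + 1) q) := by
  have h1 := measurePreserving_piFinSuccAbove
    (fun _ : Fin (q + 1) => Measure.pi fun _ : Fin (p + 1) => gaussianReal 0 v) 0
  have hmeas : Measurable (Function.uncurry fun (g : Fin (p + 1) → ℝ)
      (c : Fin q → Fin (p + 1) → ℝ) (j : Fin q) => householder g *ᵥ c j) := by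
    refine measurable_pi_lambda _ fun j => measurable_pi_lambda _ fun i => ?_
    simp only [Function.uncurry, mulVec, dotProduct]
    refine Finset.measurable_sum _ fun l _ => Measurable.mul ?_ (by fun_prop)
    have := (measurable_pi_apply l).comp ((measurable_pi_apply i).comp
      (measurable_householder (p := p)))
    exact this.comp measurable_fst
  have h2 : MeasurePreserving
      (fun x : (Fin (p + 1) → ℝ) × (Fin q → Fin (p + 1) → ℝ) =>
        (x.1, fun j : Fin q => householder x.1 *ᵥ x.2 j))
      ((Measure.pi fun _ : Fin (p + 1) => gaussianReal 0 v).prod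
        (Measure.pi fun _ : Fin q => Measure.pi fun _ : Fin (p + 1) => gaussianReal 0 v))
      ((Measure.pi fun _ : Fin (p + 1) => gaussianReal 0 v).prod
        (Measure.pi fun _ : Fin q => Measure.pi fun _ : Fin (p + 1) => gaussianReal 0 v)) :=
    (MeasurePreserving.id _).skew_product hmeas (ae_of_all _ fun g =>
      (measurePreserving_pi _ _ fun _ => measurePreserving_mulVec_gaussian v (householder g)
        fun x => householder_dotProduct g x x).map_eq)
  have h3 := measurePreserving_snd.comp (h2.comp h1)
  exact (measurePreserving_transpose_gaussianMatrixVar v q (p + 1)).comp h3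

end Step

section QuadraticForm

variable {p q : ℕ}

lemma householder_involutive (g x : Fin (p + 1) → ℝ) :
    householder g *ᵥ (householder g *ᵥ x) = x := by
  refine dotProduct_eq _ _ fun y => ?_
  have h : ∀ z w, (householder g *ᵥ z) ⬝ᵥ w = z ⬝ᵥ (householder g *ᵥ w) := by
    intro z w
    rw [dotProduct_mulVec, ← mulVec_transpose, householder_transpose]
  rw [h, householder_dotProduct]

lemma vecMul_eq_add_tail (C : Matrix (Fin (q + 1)) (Fin p) ℝ) (x : Fin (q + 1) → ℝ) :
    x ᵥ* C = x 0 • C 0 + ∑ j : Fin q, x j.succ • C j.succ := by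
  rw [vecMul_eq_sum, Fin.sum_univ_succ]

lemma reflectRest_mulVec (C : Matrix (Fin (q + 1)) (Fin (p + 1)) ℝ) (x : Fin (q + 1) → ℝ) :
    householder (C 0) *ᵥ (x ᵥ* C) =
      Pi.single 0 (√(C 0 ⬝ᵥ C 0) * x 0) + reflectRest C *ᵥ Fin.tail x := by
  rw [vecMul_eq_add_tail, mulVec_add, mulVec_smul, householder_mulVec_self, reflectRest,
    mulVec_transpose, vecMul_eq_sum, mulVec_sum]
  congr 1
  · rw [← Pi.single_smul, smul_eq_mul, mul_comm]
  · simp only [mulVec_smul]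
    rfl

lemma single_add_dotProduct_self (s : ℝ) (z : Fin (p + 1) → ℝ) :
    (Pi.single 0 s + z) ⬝ᵥ (Pi.single 0 s + z) = (s + z 0) ^ 2 + ∑ j : Fin p, z j.succ ^ 2 := by
  simp only [dotProduct, Fin.sum_univ_succ, Pi.add_apply, Pi.single_eq_same, pow_two]
  simp

/-- One step of bidiagonalization, at the level of quadratic forms. -/
lemma quadForm_bidiagonalize (C : Matrix (Fin (q + 2)) (Fin (p + 1)) ℝ) (x : Fin (q + 2) → ℝ) :
    (x ᵥ* C) ⬝ᵥ (x ᵥ* C) =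
      (√(C 0 ⬝ᵥ C 0) * x 0 + √(reflectRest C 0 ⬝ᵥ reflectRest C 0) *
        (householder (reflectRest C 0) *ᵥ Fin.tail x) 0) ^ 2 +
      ((householder (reflectRest C 0) *ᵥ Fin.tail x) ᵥ* reflectRest (reflectRest C)) ⬝ᵥ
        ((householder (reflectRest C 0) *ᵥ Fin.tail x) ᵥ* reflectRest (reflectRest C)) := by
  rw [← householder_dotProduct (C 0), reflectRest_mulVec, single_add_dotProduct_self]
  set T := reflectRest C
  have h0 : (T *ᵥ Fin.tail x) 0 =
      √(T 0 ⬝ᵥ T 0) * (householder (T 0) *ᵥ Fin.tail x) 0 := by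
    change T 0 ⬝ᵥ Fin.tail x = _
    rw [← householder_dotProduct (T 0), householder_mulVec_self, single_dotProduct]
  have h1 : ∀ j : Fin p, (T *ᵥ Fin.tail x) j.succ =
      ((householder (T 0) *ᵥ Fin.tail x) ᵥ* reflectRest T) j := by
    intro j
    rw [reflectRest, vecMul_transpose]
    exact (householder_dotProduct (T 0) _ _).symm
  rw [h0]
  simp only [h1, pow_two, dotProduct]

lemma dotProduct_self_eq_sq_add_tail (x : Fin (q + 1) → ℝ) :
    x ⬝ᵥ x = x 0 ^ 2 + Fin.tail x ⬝ᵥ Fin.tail x := by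
  simp [dotProduct, Fin.sum_univ_succ, pow_two, Fin.tail]

lemma measure_row_zero_le (v : ℝ≥0) (A : Set (Fin p → ℝ)) :
    gaussianMatrixVar v (q + 1) p {C | C 0 ∈ A} ≤
      (Measure.pi fun _ : Fin p => gaussianReal 0 v) A :=
  (measurePreserving_eval (fun _ : Fin (q + 1) => Measure.pi fun _ : Fin p => gaussianReal 0 v)
    0).measure_preimage_le A

lemma measure_bidiagonalize_le (v : ℝ≥0) {S : Set (Matrix (Fin (q + 2)) (Fin (p + 1)) ℝ)}
    {A : Set (Fin (p + 1) → ℝ)} {B : Set (Fin (q + 1) → ℝ)}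
    {S' : Set (Matrix (Fin (q + 1)) (Fin p) ℝ)}
    (h : ∀ C ∈ S, C 0 ∈ A ∨ reflectRest C 0 ∈ B ∨ reflectRest (reflectRest C) ∈ S') :
    gaussianMatrixVar v (q + 2) (p + 1) S ≤
      (Measure.pi fun _ : Fin (p + 1) => gaussianReal 0 v) A +
      (Measure.pi fun _ : Fin (q + 1) => gaussianReal 0 v) B + gaussianMatrixVar v (q + 1) p S' := by
  have hr := measurePreserving_reflectRest v p (q + 1)
  have hrr := (measurePreserving_reflectRest v q p).comp hr
  have hsub : S ⊆ ({C | C 0 ∈ A} ∪ reflectRest ⁻¹' {T | T 0 ∈ B}) ∪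
      (reflectRest ∘ reflectRest) ⁻¹' S' := by
    intro C hC
    rcases h C hC with h | h | h
    exacts [Or.inl (Or.inl h), Or.inl (Or.inr h), Or.inr h]
  refine (measure_mono hsub).trans ((measure_union_le _ _).trans ?_)
  refine add_le_add ((measure_union_le _ _).trans (add_le_add ?_ ?_)) ?_
  · exact measure_row_zero_le v A
  · exact (hr.measure_preimage_le _).trans (measure_row_zero_le v B)
  · exact hrr.measure_preimage_le _

end QuadraticForm

section LowerBound

lemma le_sq_add_of_mul_le {A B l s x y : ℝ} (hA : 0 ≤ A) (hB : 0 ≤ B) (hs : 0 < s)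
    (h : (l + s) * (B + s) ≤ A * s) :
    l * x ^ 2 + s * x ^ 2 ≤ (√A * x + √B * y) ^ 2 + s * y ^ 2 := by
  have ha := Real.mul_self_sqrt hA
  have hb := Real.mul_self_sqrt hB
  set a := √A
  set b := √B
  have hBs : 0 < B + s := by linarith
  rw [← sub_nonneg, ← mul_nonneg_iff_of_pos_left hBs]
  have e : (B + s) * ((a * x + b * y) ^ 2 + s * y ^ 2 - (l * x ^ 2 + s * x ^ 2)) =
      ((B + s) * y + a * b * x) ^ 2 + (A * s - (l + s) * (B + s)) * x ^ 2 := by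
    rw [← ha, ← hb]
    ring
  rw [e]
  exact add_nonneg (sq_nonneg _) (mul_nonneg (by linarith) (sq_nonneg _))

/-- With high probability the quadratic form of a Gaussian matrix stays above `l`. -/
lemma measure_not_lower_le {l s ε : ℝ} (hl : 0 ≤ l) (hs : 0 < s) (hε : 0 ≤ ε) (v : ℝ≥0)
    (η : ℝ≥0∞) : ∀ n p : ℕ, n ≤ p →
    (∀ j ≤ p + 1, (Measure.pi fun _ : Fin j => gaussianReal 0 v) {x | ε < |x ⬝ᵥ x - j * v|} ≤ η) →
    (l + s) * (n * v + ε + s) ≤ ((p + 1) * v - ε) * s →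
    gaussianMatrixVar v (n + 1) (p + 1)
      {C | ¬ ∀ x, l * (x ⬝ᵥ x) + s * x 0 ^ 2 ≤ (x ᵥ* C) ⬝ᵥ (x ᵥ* C)} ≤ (2 * n + 1) * η := by
  intro n
  induction n with
  | zero =>
    intro p _ hη hc
    have hsub : {C : Matrix (Fin 1) (Fin (p + 1)) ℝ | ¬ ∀ x, l * (x ⬝ᵥ x) + s * x 0 ^ 2 ≤
        (x ᵥ* C) ⬝ᵥ (x ᵥ* C)} ⊆
        {C | C 0 ∈ {g : Fin (p + 1) → ℝ | ε < |g ⬝ᵥ g - (p + 1 : ℕ) * v|}} := by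
      intro C hC
      by_contra hC'
      simp only [Set.mem_ofPred_eq, not_lt] at hC'
      apply hC
      intro x
      have h1 := (abs_le.1 hC').1
      push_cast at h1
      have hA : l + s ≤ C 0 ⬝ᵥ C 0 := by
        push_cast at hc
        have : l + s ≤ (p + 1) * v - ε := by
          refine le_of_mul_le_mul_right (le_trans ?_ hc) hs
          gcongr
          linarith
        linarith
      rw [vecMul_eq_add_tail, dotProduct_self_eq_sq_add_tail]
      simp only [Finset.univ_eq_empty, Finset.sum_empty, add_zero, dotProduct_smul,
        smul_dotProduct, smul_eq_mul]
      have : Fin.tail x ⬝ᵥ Fin.tail x = 0 := by simp [dotProduct]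
      rw [this]
      nlinarith [mul_le_mul_of_nonneg_left hA (sq_nonneg (x 0))]
    refine (measure_mono hsub).trans ((measure_row_zero_le v _).trans ?_)
    simpa using hη (p + 1) le_rfl
  | succ n ih =>
    intro p hp hη hc
    obtain ⟨p, rfl⟩ : ∃ p', p = p' + 1 := ⟨p - 1, by omega⟩
    have hv : (0 : ℝ) ≤ v := v.2
    push_cast at hc
    have hc' : (l + s) * (n * v + ε + s) ≤ ((p + 1) * v - ε) * s := by
      nlinarith [mul_nonneg hl hv]
    have ih' := ih p (by omega) (fun j hj => hη j (by omega)) hc'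
    have hη1 := hη (p + 1 + 1) le_rfl
    have hη2 := hη (n + 1) (by omega)
    refine (measure_bidiagonalize_le v (A := {g | ε < |g ⬝ᵥ g - (p + 1 + 1 : ℕ) * v|})
      (B := {g | ε < |g ⬝ᵥ g - (n + 1 : ℕ) * v|})
      (S' := {C | ¬ ∀ x, l * (x ⬝ᵥ x) + s * x 0 ^ 2 ≤ (x ᵥ* C) ⬝ᵥ (x ᵥ* C)}) ?_).trans ?_
    · intro C hC
      by_contra hcon
      simp only [Set.mem_ofPred_eq, not_or, not_lt, not_not] at hcon
      obtain ⟨h1, h2, h3⟩ := hcon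
      apply hC
      intro x
      have h1' := (abs_le.1 h1).1
      have h2' := (abs_le.1 h2).2
      push_cast at h1' h2'
      have h3' := h3 (householder (reflectRest C 0) *ᵥ Fin.tail x)
      rw [householder_dotProduct] at h3'
      rw [quadForm_bidiagonalize, dotProduct_self_eq_sq_add_tail]
      have hB0 := dotProduct_self_nonneg_real (reflectRest C 0)
      have hnv : 0 ≤ (n : ℝ) * v := by positivity
      have hAB : (l + s) * (reflectRest C 0 ⬝ᵥ reflectRest C 0 + s) ≤ (C 0 ⬝ᵥ C 0) * s := by
        refine le_trans ?_ (hc.trans ?_)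
        · gcongr; linarith
        · gcongr; linarith
      have := le_sq_add_of_mul_le (x := x 0)
        (y := (householder (reflectRest C 0) *ᵥ Fin.tail x) 0) (dotProduct_self_nonneg_real _) hB0 hs hAB
      linarith
    · calc _ ≤ η + η + (2 * n + 1) * η := add_le_add (add_le_add hη1 hη2) ih'
        _ = (2 * ((n + 1 : ℕ) : ℝ≥0∞) + 1) * η := by push_cast; ring

end LowerBound

section UpperBound

/-- With high probability a Gaussian matrix admits a test vector with small Rayleigh quotient. -/
lemma measure_not_upper_le {κ ε α c : ℝ} (hc : 1 + ε ≤ c) (v : ℝ≥0) (η : ℝ≥0∞)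
    (hκ : ∀ A B : ℝ, |A - 1| ≤ ε → |B - α| ≤ ε → (√A - √B) ^ 2 ≤ κ) : ∀ N n p : ℕ, N ≤ n → N ≤ p →
    (∀ j ≤ p + 1, p + 1 ≤ j + N →
      (Measure.pi fun _ : Fin j => gaussianReal 0 v) {x | ε < |x ⬝ᵥ x - 1|} ≤ η) →
    (∀ j ≤ n, n ≤ j + N →
      (Measure.pi fun _ : Fin j => gaussianReal 0 v) {x | ε < |x ⬝ᵥ x - α|} ≤ η) →
    gaussianMatrixVar v (n + 1) (p + 1)
      {C | ¬ ∃ x : Fin (n + 1) → ℝ, x 0 = 1 ∧ x ⬝ᵥ x = N + 1 ∧ (x ᵥ* C) ⬝ᵥ (x ᵥ* C) ≤ N * κ + c} ≤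
      (2 * N + 1) * η := by
  intro N
  induction N with
  | zero =>
    intro n p _ _ hη _
    have hsub : {C : Matrix (Fin (n + 1)) (Fin (p + 1)) ℝ | ¬ ∃ x : Fin (n + 1) → ℝ, x 0 = 1 ∧
        x ⬝ᵥ x = (0 : ℕ) + 1 ∧ (x ᵥ* C) ⬝ᵥ (x ᵥ* C) ≤ (0 : ℕ) * κ + c} ⊆
        {C | C 0 ∈ {g | ε < |g ⬝ᵥ g - 1|}} := by
      intro C hC
      by_contra hC'
      simp only [Set.mem_ofPred_eq, not_lt] at hC'
      apply hC
      have h1 := (abs_le.1 hC').2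
      refine ⟨Pi.single 0 1, by simp, by simp, ?_⟩
      rw [single_one_vecMul]
      change C 0 ⬝ᵥ C 0 ≤ _
      push_cast
      linarith
    refine (measure_mono hsub).trans ((measure_row_zero_le v _).trans ?_)
    simpa using hη (p + 1) le_rfl (by omega)
  | succ N ih =>
    intro n p hn hp hη hη'
    obtain ⟨p, rfl⟩ : ∃ p', p = p' + 1 := ⟨p - 1, by omega⟩
    obtain ⟨n, rfl⟩ : ∃ n', n = n' + 1 := ⟨n - 1, by omega⟩
    have ih' := ih n p (by omega) (by omega) (fun j hj hj' => hη j (by omega) (by omega))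
      (fun j hj hj' => hη' j (by omega) (by omega))
    have hη1 := hη (p + 1 + 1) le_rfl (by omega)
    have hη2 := hη' (n + 1) le_rfl (by omega)
    refine (measure_bidiagonalize_le v (A := {g | ε < |g ⬝ᵥ g - 1|})
      (B := {g | ε < |g ⬝ᵥ g - α|})
      (S' := {C | ¬ ∃ x : Fin (n + 1) → ℝ, x 0 = 1 ∧ x ⬝ᵥ x = N + 1 ∧
        (x ᵥ* C) ⬝ᵥ (x ᵥ* C) ≤ N * κ + c}) ?_).trans ?_
    · intro C hC
      by_contra hcon
      simp only [Set.mem_ofPred_eq, not_or, not_lt, not_not] at hcon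
      obtain ⟨h1, h2, h3⟩ := hcon
      apply hC
      obtain ⟨y, hy0, hyy, hyC⟩ := h3
      refine ⟨Fin.cons 1 (-(householder (reflectRest C 0) *ᵥ y)), rfl, ?_, ?_⟩
      · rw [dotProduct_self_eq_sq_add_tail, Fin.tail_cons, Fin.cons_zero, neg_dotProduct_neg,
          householder_dotProduct, hyy]
        push_cast
        ring
      · rw [quadForm_bidiagonalize, Fin.tail_cons, Fin.cons_zero, mulVec_neg,
          householder_involutive, neg_vecMul, neg_dotProduct_neg, Pi.neg_apply, hy0]
        have := hκ _ _ h1 h2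
        push_cast
        linarith
    · calc _ ≤ η + η + (2 * N + 1) * η := add_le_add (add_le_add hη1 hη2) ih'
        _ = (2 * ((N + 1 : ℕ) : ℝ≥0∞) + 1) * η := by push_cast; ring

end UpperBound

section Eigenvalue

variable {d k : ℕ}

lemma forall_mul_dotProduct_le_iff_forall_spectrum {M : Matrix (Fin d) (Fin d) ℝ}
    (hM : M.IsHermitian) (l : ℝ) :
    (∀ x : Fin d → ℝ, l * (x ⬝ᵥ x) ≤ x ⬝ᵥ (M *ᵥ x)) ↔ ∀ t ∈ spectrum ℝ M, l ≤ t := by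
  have hN : (M - algebraMap ℝ _ l).IsHermitian := by
    rw [algebraMap_eq_diagonal]
    exact hM.sub (isHermitian_diagonal _)
  have hspec : ∀ t, t ∈ spectrum ℝ M ↔ t - l ∈ spectrum ℝ (M - algebraMap ℝ _ l) := by
    intro t
    rw [spectrum.mem_iff, spectrum.mem_iff, map_sub, sub_sub_sub_cancel_right]
  have hquad : ∀ x : Fin d → ℝ, x ⬝ᵥ ((M - algebraMap ℝ _ l) *ᵥ x) =
      x ⬝ᵥ (M *ᵥ x) - l * (x ⬝ᵥ x) := by
    intro x
    rw [Algebra.algebraMap_eq_smul_one, sub_mulVec, smul_mulVec, one_mulVec, dotProduct_sub,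
      dotProduct_smul, smul_eq_mul]
  have h1 := posSemidef_iff_isHermitian_and_spectrum_nonneg (A := M - algebraMap ℝ _ l)
  have h2 := posSemidef_iff_dotProduct_mulVec (M := M - algebraMap ℝ _ l)
  simp only [star_trivial, hN, true_and, hquad, sub_nonneg] at h1 h2
  rw [← h2, h1]
  constructor
  · intro h t ht
    have := h ((hspec t).1 ht)
    simpa using this
  · intro h t ht
    have := h (t + l) ((hspec _).2 (by simpa using ht))
    simpa using this

lemma dotProduct_gram_mulVec (G : Matrix (Fin k) (Fin d) ℝ) (x : Fin d → ℝ) :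
    x ⬝ᵥ ((Gᵀ * G) *ᵥ x) = (x ᵥ* Gᵀ) ⬝ᵥ (x ᵥ* Gᵀ) := by
  rw [← mulVec_mulVec, dotProduct_mulVec, vecMul_transpose]

lemma isHermitian_gram (G : Matrix (Fin k) (Fin d) ℝ) : (Gᵀ * G).IsHermitian := by
  simpa [conjTranspose_eq_transpose_of_trivial] using isHermitian_conjTranspose_mul_self G

lemma le_lambdaMin_gram (hd : 0 < d) (G : Matrix (Fin k) (Fin d) ℝ) {l : ℝ}
    (h : ∀ x : Fin d → ℝ, l * (x ⬝ᵥ x) ≤ (x ᵥ* Gᵀ) ⬝ᵥ (x ᵥ* Gᵀ)) : l ≤ lambdaMin (Gᵀ * G) := by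
  have hM := isHermitian_gram G
  refine le_csInf ?_ ((forall_mul_dotProduct_le_iff_forall_spectrum hM l).1 ?_)
  · rw [hM.spectrum_real_eq_range_eigenvalues]
    have : Nonempty (Fin d) := ⟨⟨0, hd⟩⟩
    exact Set.range_nonempty _
  · simpa only [dotProduct_gram_mulVec] using h

lemma lambdaMin_gram_le (G : Matrix (Fin k) (Fin d) ℝ) {μ : ℝ} (x : Fin d → ℝ)
    (hx : 0 < x ⬝ᵥ x) (h : (x ᵥ* Gᵀ) ⬝ᵥ (x ᵥ* Gᵀ) ≤ μ * (x ⬝ᵥ x)) :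
    lambdaMin (Gᵀ * G) ≤ μ := by
  have hbdd := (Gᵀ * G).finite_real_spectrum.bddBelow
  have := (forall_mul_dotProduct_le_iff_forall_spectrum (isHermitian_gram G)
    (lambdaMin (Gᵀ * G))).2 (fun t ht => csInf_le hbdd ht) x
  rw [dotProduct_gram_mulVec] at this
  exact le_of_mul_le_mul_right (this.trans h) hx

end Eigenvalue

section Limit

lemma tendsto_ofReal_mul_exp_neg {c : ℝ} (hc : 0 < c) :
    Tendsto (fun K : ℕ => ENNReal.ofReal (4 * K * Real.exp (-c * K))) atTop (nhds 0) := by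
  have h := (Real.tendsto_pow_mul_exp_neg_atTop_nhds_zero 1).comp
    ((tendsto_natCast_atTop_atTop (R := ℝ)).const_mul_atTop hc)
  have h2 := (h.const_mul (4 / c))
  rw [mul_zero] at h2
  rw [← ENNReal.ofReal_zero]
  refine ENNReal.tendsto_ofReal (h2.congr fun K => ?_)
  simp only [Function.comp, pow_one, neg_mul]
  field_simp

lemma two_mul_add_one_mul_ofReal_le {n K : ℕ} (h : n < K) (c : ℝ) :
    (2 * n + 1) * ENNReal.ofReal (2 * Real.exp (-c * K)) ≤
      ENNReal.ofReal (4 * K * Real.exp (-c * K)) := by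
  have e : (2 * n + 1 : ℝ≥0∞) = ENNReal.ofReal (2 * n + 1) := by
    rw [ENNReal.ofReal_add (by positivity) zero_le_one, ENNReal.ofReal_mul (by norm_num)]
    simp
  rw [e, ← ENNReal.ofReal_mul (by positivity)]
  apply ENNReal.ofReal_le_ofReal
  have h1 : (2 * n + 1 : ℝ) ≤ 2 * K := by
    have : (n + 1 : ℝ) ≤ K := by exact_mod_cast h
    linarith
  nlinarith [Real.exp_pos (-c * K)]

variable {k d : ℕ → ℕ} {α : ℝ}

lemma tendsto_measure_lambdaMin_lt (hα0 : 0 < α) (hdk : ∀ m, d m ≤ k m)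
    (htd : Tendsto (fun m => d m) atTop atTop) (htk : Tendsto (fun m => k m) atTop atTop)
    (hratio : Tendsto (fun m => (d m : ℝ) / (k m : ℝ)) atTop (nhds α)) (hα1 : α ≤ 1)
    {δ : ℝ} (hδ : 0 < δ) :
    Tendsto (fun m => gaussianMatrix (k m) (d m)
      {G | lambdaMin (Gᵀ * G) < (1 - √α) ^ 2 - δ}) atTop (nhds 0) := by
  have ha0 : 0 < √α := Real.sqrt_pos.2 hα0
  have ha1 : √α ≤ 1 := Real.sqrt_le_one.2 hα1
  have haa : √α * √α = α := Real.mul_self_sqrt hα0.le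
  set a := √α
  rcases lt_or_ge ((1 - a) ^ 2) δ with hneg | hl
  · refine tendsto_const_nhds.congr' ?_
    filter_upwards [htd.eventually_ge_atTop 1] with m hm
    symm
    convert measure_empty (μ := gaussianMatrix (k m) (d m))
    ext G
    simp only [Set.mem_ofPred_eq, Set.mem_empty_iff_false, iff_false, not_lt]
    refine le_trans (by linarith) (le_lambdaMin_gram hm G (l := 0) fun x => ?_)
    rw [zero_mul]
    exact dotProduct_self_nonneg_real _
  · have ha1' : a < 1 := by
      refine lt_of_le_of_ne ha1 fun h => ?_
      rw [h] at hl
      norm_num at hl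
      linarith
    have hδ1 : δ ≤ 1 := by nlinarith
    set l := (1 - a) ^ 2 - δ with hl_def
    set s := a * (1 - a) with hs_def
    set ε := δ * a / 3 with hε_def
    have hs : 0 < s := mul_pos ha0 (by linarith)
    have hε : 0 < ε := by positivity
    have hε1 : ε ≤ 1 := by rw [hε_def]; nlinarith
    refine tendsto_of_tendsto_of_tendsto_of_le_of_le' tendsto_const_nhds
      ((tendsto_ofReal_mul_exp_neg (c := ε ^ 2 / 8) (by positivity)).comp htk)
      (Eventually.of_forall fun _ => zero_le) ?_
    filter_upwards [htd.eventually_ge_atTop 1,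
      hratio.eventually (gt_mem_nhds (show α < α + ε by linarith))] with m hm hrat
    have hdkm := hdk m
    obtain ⟨n, hn⟩ : ∃ n, d m = n + 1 := ⟨d m - 1, by omega⟩
    obtain ⟨p, hp⟩ : ∃ p, k m = p + 1 := ⟨k m - 1, by omega⟩
    rw [hn, hp] at hrat
    rw [Function.comp, hn, hp]
    rw [hn, hp] at hdkm
    have hvj : ∀ j : ℝ, j * ((1 / (p + 1 : ℕ) : ℝ≥0) : ℝ) = j / (p + 1 : ℕ) := by
      intro j; push_cast; ring
    have key := measure_not_lower_le (l := l) (s := s) (ε := ε) (by linarith) hs hε.le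
      (1 / (p + 1 : ℕ)) (ENNReal.ofReal (2 * Real.exp (-(ε ^ 2 / 8) * (p + 1 : ℕ)))) n p (by omega)
      (fun j hj => by
        simp only [hvj]
        exact measure_abs_sum_sq_sub_gt_le p.succ_pos hj hε hε1) (by
        rw [hvj, hvj]
        have h1 : ((p : ℝ) + 1) / (p + 1 : ℕ) = 1 := by
          push_cast; exact div_self (by positivity)
        have h2 : (n : ℝ) / (p + 1 : ℕ) ≤ α + ε := by
          refine le_trans ?_ hrat.le
          push_cast
          gcongr
          linarith
        rw [h1]
        have h3 : l + s = 1 - a - δ := by rw [hl_def, hs_def]; ring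
        have h4 : 0 ≤ l + s := by linarith
        have h5 : (l + s) * (n / (p + 1 : ℕ) + ε + s) ≤ (l + s) * (a + 2 * ε) := by
          apply mul_le_mul_of_nonneg_left _ h4
          rw [hs_def]
          linarith
        refine h5.trans ?_
        rw [h3, hs_def]
        have h6 : 3 * ε = δ * a := by rw [hε_def]; ring
        have h7 : ε * (2 * (1 - a - δ) + a * (1 - a)) ≤ ε * 3 :=
          mul_le_mul_of_nonneg_left (by nlinarith) hε.le
        nlinarith)
    refine le_trans ?_ (key.trans (two_mul_add_one_mul_ofReal_le (by omega) _))
    refine le_trans (measure_mono ?_) ((measurePreserving_transpose_gaussianMatrixVar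
      (1 / (p + 1 : ℕ)) (p + 1) (n + 1)).measure_preimage_le _)
    intro G hG
    by_contra hcon
    simp only [Set.mem_preimage, Set.mem_ofPred_eq, not_not] at hcon hG
    refine absurd hG (not_lt.2 (le_lambdaMin_gram n.succ_pos G fun x => ?_))
    have := hcon x
    nlinarith [mul_nonneg hs.le (sq_nonneg (x 0))]

lemma exists_forall_sq_sqrt_sub_sqrt_le (α : ℝ) {δ : ℝ} (hδ : 0 < δ) :
    ∃ ε, 0 < ε ∧ ε ≤ 1 ∧ ∀ A B : ℝ, |A - 1| ≤ ε → |B - α| ≤ ε →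
      (√A - √B) ^ 2 ≤ (1 - √α) ^ 2 + δ := by
  have hc : Continuous fun z : ℝ × ℝ => (√z.1 - √z.2) ^ 2 := by fun_prop
  obtain ⟨ε, hε, h⟩ := Metric.continuousAt_iff.1 (hc.continuousAt (x := (1, α))) δ hδ
  refine ⟨min (ε / 2) 1, by positivity, min_le_right _ _, fun A B hA hB => ?_⟩
  have hm := min_le_left (ε / 2) 1
  have := @h (A, B) (by
    rw [Prod.dist_eq, max_lt_iff, Real.dist_eq, Real.dist_eq]
    exact ⟨by simp only; linarith, by simp only; linarith⟩)
  rw [Real.dist_eq] at this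
  have := (abs_lt.1 this).2
  simp only [Real.sqrt_one] at this
  linarith

lemma tendsto_measure_lt_lambdaMin (hdk : ∀ m, d m ≤ k m)
    (htd : Tendsto (fun m => d m) atTop atTop) (htk : Tendsto (fun m => k m) atTop atTop)
    (hratio : Tendsto (fun m => (d m : ℝ) / (k m : ℝ)) atTop (nhds α)) {δ : ℝ} (hδ : 0 < δ) :
    Tendsto (fun m => gaussianMatrix (k m) (d m)
      {G | (1 - √α) ^ 2 + δ < lambdaMin (Gᵀ * G)}) atTop (nhds 0) := by
  obtain ⟨ε, hε, hε1, hκ⟩ := exists_forall_sq_sqrt_sub_sqrt_le α (half_pos hδ)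
  obtain ⟨N, hN⟩ := exists_nat_gt (4 / δ)
  rw [div_lt_iff₀ hδ] at hN
  refine tendsto_of_tendsto_of_tendsto_of_le_of_le' tendsto_const_nhds
    ((tendsto_ofReal_mul_exp_neg (c := (ε / 2) ^ 2 / 8) (by positivity)).comp htk)
    (Eventually.of_forall fun _ => zero_le) ?_
  have hsmall : Tendsto (fun m => ((N : ℝ) + 1) / k m) atTop (nhds 0) :=
    ((tendsto_natCast_atTop_atTop (R := ℝ)).comp htk).const_div_atTop _
  filter_upwards [htd.eventually_ge_atTop (N + 1),
    hratio.eventually (Metric.ball_mem_nhds α (show 0 < ε / 4 by positivity)),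
    hsmall.eventually (gt_mem_nhds (show 0 < ε / 4 by positivity))] with m hm hrat hsm
  have hdkm := hdk m
  obtain ⟨n, hn⟩ : ∃ n, d m = n + 1 := ⟨d m - 1, by omega⟩
  obtain ⟨p, hp⟩ : ∃ p, k m = p + 1 := ⟨k m - 1, by omega⟩
  rw [Real.dist_eq, hn, hp] at hrat
  rw [hn, hp] at hdkm
  rw [hn] at hm
  rw [hp] at hsm
  rw [Function.comp, hn, hp]
  obtain ⟨hr1, hr2⟩ := abs_lt.1 hrat
  have hK : (0 : ℝ) < (p + 1 : ℕ) := by positivity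
  have htail : ∀ (j : ℕ) (t : ℝ), j ≤ p + 1 → |(j : ℝ) / (p + 1 : ℕ) - t| ≤ ε / 2 →
      (Measure.pi fun _ : Fin j => gaussianReal 0 (1 / (p + 1 : ℕ))) {x | ε < |x ⬝ᵥ x - t|} ≤
        ENNReal.ofReal (2 * Real.exp (-((ε / 2) ^ 2 / 8) * (p + 1 : ℕ))) := by
    intro j t hj ht
    refine (measure_mono ?_).trans (measure_abs_sum_sq_sub_gt_le p.succ_pos hj (half_pos hε)
      (by linarith))
    intro x hx
    simp only [Set.mem_ofPred_eq] at hx ⊢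
    have := abs_sub_le (x ⬝ᵥ x) ((j : ℝ) / (p + 1 : ℕ)) t
    linarith
  have key := measure_not_upper_le (c := 2) (by linarith) (1 / (p + 1 : ℕ))
    (ENNReal.ofReal (2 * Real.exp (-((ε / 2) ^ 2 / 8) * (p + 1 : ℕ)))) hκ N n p (by omega)
    (by omega)
    (fun j hj hj' => htail j 1 hj (by
      have h1 : (j : ℝ) / (p + 1 : ℕ) ≤ 1 := by
        rw [div_le_one hK]; exact_mod_cast hj
      have h2 : 1 ≤ (j : ℝ) / (p + 1 : ℕ) + (N + 1) / (p + 1 : ℕ) := by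
        rw [← add_div, one_le_div hK]
        exact_mod_cast (by omega : p + 1 ≤ j + (N + 1))
      rw [abs_le]
      constructor <;> linarith))
    (fun j hj hj' => htail j α (by omega) (by
      have h1 : (j : ℝ) / (p + 1 : ℕ) ≤ (n + 1 : ℕ) / (p + 1 : ℕ) := by
        gcongr
        omega
      have h2 : ((n + 1 : ℕ) : ℝ) / (p + 1 : ℕ) ≤ j / (p + 1 : ℕ) + (N + 1) / (p + 1 : ℕ) := by
        rw [← add_div]
        gcongr
        exact_mod_cast (by omega : n + 1 ≤ j + (N + 1))
      rw [abs_le]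
      constructor <;> linarith))
  refine le_trans ?_ (key.trans (two_mul_add_one_mul_ofReal_le (by omega) _))
  refine le_trans (measure_mono ?_) ((measurePreserving_transpose_gaussianMatrixVar
    (1 / (p + 1 : ℕ)) (p + 1) (n + 1)).measure_preimage_le _)
  intro G hG
  by_contra hcon
  simp only [Set.mem_preimage, Set.mem_ofPred_eq, not_not] at hcon hG
  obtain ⟨x, -, hxx, hxG⟩ := hcon
  refine absurd hG (not_lt.2 (lambdaMin_gram_le G x (by rw [hxx]; positivity) ?_))
  rw [hxx]
  refine hxG.trans ?_
  nlinarith [sq_nonneg (1 - √α)]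

end Limit

/-- (Silverstein) For Wishart matrices `Gᵀ G` with `G` a `k_m × d_m` matrix of independent
`N(0, 1/k_m)` entries, `d_m ≤ k_m`, `d_m, k_m → ∞` and `d_m / k_m → α ∈ (0, 1]`,
the smallest eigenvalue converges in probability to `(1 − √α)²`. -/
theorem lambdaMin_wishart_tendsto
    (k d : ℕ → ℕ) (α : ℝ) (hα0 : 0 < α) (hα1 : α ≤ 1)
    (hdk : ∀ m, d m ≤ k m)
    (htd : Tendsto (fun m => d m) atTop atTop)
    (htk : Tendsto (fun m => k m) atTop atTop)
    (hratio : Tendsto (fun m => (d m : ℝ) / (k m : ℝ)) atTop (nhds α)) :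
    ∀ δ : ℝ, 0 < δ →
      Tendsto
        (fun m => gaussianMatrix (k m) (d m)
          {G | δ < |lambdaMin (Gᵀ * G) - (1 - Real.sqrt α) ^ 2|})
        atTop (nhds 0) := by
  intro δ hδ
  have h := (tendsto_measure_lambdaMin_lt hα0 hdk htd htk hratio hα1 hδ).add
    (tendsto_measure_lt_lambdaMin hdk htd htk hratio hδ)
  rw [add_zero] at h
  refine tendsto_of_tendsto_of_tendsto_of_le_of_le tendsto_const_nhds h
    (fun _ => zero_le) fun m => ?_
  refine (measure_mono fun G hG => ?_).trans (measure_union_le _ _)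
  rcases lt_abs.1 (show δ < |lambdaMin (Gᵀ * G) - (1 - √α) ^ 2| from hG) with h | h
  · right
    simp only [Set.mem_ofPred_eq]
    linarith
  · left
    simp only [Set.mem_ofPred_eq]
    linarith
end
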